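/- arXiv:2410.22147 — 7 statements merged into one kernel-verified Lean document; each statement's English description precedes it below -/
import Mathlib

section
/- Let A be an integer m×n matrix with rows a₁, …, a_m, and let R be any square submatrix of A (obtained by selecting an equal number of rows and columns of A). Then |det(R)| ≤ ∏_{i=1}^m max(1, ‖a_i‖₂), where ‖·‖₂ denotes the Euclidean norm of a row vector. -/
/-- **Hadamard's inequality**: the determinant of a real square matrix is at most the product of the
Euclidean norms of its rows. -/
theorem Matrix.abs_det_le_prod_sqrt_sum_sq {w : ℕ} (M : Matrix (Fin w) (Fin w) ℝ) :
    |M.det| ≤ ∏ i, Real.sqrt (∑ j, M i j ^ 2) := by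
  have : Fact (Module.finrank ℝ (EuclideanSpace ℝ (Fin w)) = w) := ⟨by simp⟩
  let b := EuclideanSpace.basisFun (Fin w) ℝ
  have h := b.toBasis.orientation.abs_volumeForm_apply_le fun i => WithLp.toLp 2 (M i)
  rw [b.toBasis.orientation.volumeForm_robust b rfl, Module.Basis.det_apply] at h
  have hM : b.toBasis.toMatrix (fun i => WithLp.toLp 2 (M i)) = M.transpose := by
    ext i j
    simp [b, Module.Basis.toMatrix_apply]
  simpa [hM, EuclideanSpace.norm_eq] using h

/-- Hadamard-type bound: for an integer `m × n` matrix `A` with rows `a₁, …, a_m`,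
every square submatrix `R` of `A` satisfies
`|det R| ≤ ∏_{i=1}^m max(1, ‖a_i‖₂)`. -/
theorem abs_det_submatrix_le_prod_max_norm {m n : ℕ} (A : Matrix (Fin m) (Fin n) ℤ)
    (w : ℕ) (r : Fin w → Fin m) (c : Fin w → Fin n)
    (hr : Function.Injective r) (hc : Function.Injective c) :
    |((A.submatrix r c).det : ℝ)| ≤
      ∏ i : Fin m, max 1 (Real.sqrt (∑ j : Fin n, ((A i j : ℝ)) ^ 2)) := by
  have hdet : ((A.submatrix r c).det : ℝ) =
      (Matrix.of fun i j => (A (r i) (c j) : ℝ)).det :=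
    RingHom.map_det (Int.castRingHom ℝ) _
  rw [hdet]
  calc
    _ ≤ ∏ i, Real.sqrt (∑ j, (A (r i) (c j) : ℝ) ^ 2) :=
      Matrix.abs_det_le_prod_sqrt_sum_sq _
    _ ≤ ∏ i, max 1 (Real.sqrt (∑ j, (A (r i) j : ℝ) ^ 2)) := by
      refine Finset.prod_le_prod (fun _ _ => Real.sqrt_nonneg _) fun i _ => le_max_of_le_right ?_
      refine Real.sqrt_le_sqrt ?_
      rw [← Finset.sum_image (f := fun j => (A (r i) j : ℝ) ^ 2) hc.injOn]
      exact Finset.sum_le_univ_sum_of_nonneg fun _ => sq_nonneg _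
    _ ≤ _ := by
      rw [← Finset.prod_image (f := fun i => max 1 (Real.sqrt (∑ j, (A i j : ℝ) ^ 2))) hr.injOn]
      exact Finset.prod_le_prod_of_subset_of_one_le (Finset.subset_univ _)
        (fun _ _ => by positivity) fun _ _ _ => le_max_left _ _
end

section
/- Let μ, η be positive integers and a¹, …, a^μ be positive integers. Let H be the η×(η+1) integer matrix with H_{t,t} = 1, H_{t,t+1} = −1, and zeros elsewhere, and I_η the η×η identity matrix. Consider the (3μη+η)×(μ(η+1)+μη) integer block matrix A whose columns are grouped as (s¹, …, s^μ, x¹, …, x^μ) with s^i ∈ ℚ^{η+1} and x^i ∈ ℚ^{η}, and whose rows consist of: (1) for each i ∈ [μ], the rows (H on the s^i-columns, I_η on the x^i-columns, zeros elsewhere); (2) the negations of all rows in (1); (3) for each i ∈ [μ], the rows (−I_η on the x^i-columns, zeros elsewhere); and (4) the η rows with zeros on all s-columns and entries −a^i·I_η on the x^i-columns for each i ∈ [μ]. Then A is Δ-regular with Δ = lcm(a¹, …, a^μ). (This is the constraint matrix belonging to the continuous variables of the multi-item single-level lot-sizing problem with joint resource constraints.) -/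
/-- A rational matrix `A` is `Δ`-regular if for every nonsingular square submatrix `R`
of `A`, the matrix `Δ • R⁻¹` has all entries in `ℤ`. -/
def IsDeltaRegular {m n : Type*} (A : Matrix m n ℚ) (Δ : ℕ) : Prop :=
  ∀ (w : ℕ) (r : Fin w → m) (c : Fin w → n),
    Function.Injective r → Function.Injective c →
    (A.submatrix r c).det ≠ 0 →
    ∀ i j, ∃ z : ℤ, (Δ : ℚ) * (A.submatrix r c)⁻¹ i j = (z : ℚ)

/-- The `(3μη+η) × (μ(η+1)+μη)` constraint matrix of the multi-item single-level
lot-sizing problem with joint resource constraints, belonging to the continuous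
variables `(s¹, …, s^μ, x¹, …, x^μ)`.  Its rows are: for each item `i` the flow
conservation rows `(H on sⁱ, I on xⁱ)`; their negations; the rows `(-I on xⁱ)`;
and the resource rows with `-aⁱ·I` on the `xⁱ`-columns. -/
def MISLmat (μ η : ℕ) (a : Fin μ → ℕ) :
    Matrix (((Fin μ × Fin η) ⊕ (Fin μ × Fin η)) ⊕ ((Fin μ × Fin η) ⊕ Fin η))
      ((Fin μ × Fin (η + 1)) ⊕ (Fin μ × Fin η)) ℚ :=
  fun row col =>
    match row, col with
    | Sum.inl (Sum.inl (i, t)), Sum.inl (i', j) =>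
        if i' = i then (if j = t.castSucc then 1 else if j = t.succ then -1 else 0)
        else 0
    | Sum.inl (Sum.inl (i, t)), Sum.inr (i', t') =>
        if i' = i ∧ t' = t then 1 else 0
    | Sum.inl (Sum.inr (i, t)), Sum.inl (i', j) =>
        if i' = i then (if j = t.castSucc then -1 else if j = t.succ then 1 else 0)
        else 0
    | Sum.inl (Sum.inr (i, t)), Sum.inr (i', t') =>
        if i' = i ∧ t' = t then -1 else 0
    | Sum.inr (Sum.inl _), Sum.inl _ => 0
    | Sum.inr (Sum.inl (i, t)), Sum.inr (i', t') =>
        if i' = i ∧ t' = t then -1 else 0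
    | Sum.inr (Sum.inr _), Sum.inl _ => 0
    | Sum.inr (Sum.inr t), Sum.inr (i', t') =>
        if t' = t then -(a i' : ℚ) else 0

open Matrix in
/-- A square matrix with entries in `{-1, 0, 1}` in which any two nonzero entries of a column
cancel has determinant in `{-1, 0, 1}`. -/
lemma det_mem_range_signType_of_column_cancel {k : ℕ} (B : Matrix (Fin k) (Fin k) ℤ)
    (hB : ∀ i j, B i j ∈ Set.range SignType.cast)
    (hcancel : ∀ j i i', i ≠ i' → B i j ≠ 0 → B i' j ≠ 0 → B i j + B i' j = 0) :
    B.det ∈ Set.range SignType.cast := by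
  induction k with
  | zero => exact ⟨1, by simp⟩
  | succ k ih =>
    by_cases hsum : ∀ j, ∑ i, B i j = 0
    · have hdet : B.det = 0 := exists_vecMul_eq_zero_iff.mp
        ⟨1, one_ne_zero, funext fun j => by simp [vecMul, dotProduct, hsum]⟩
      exact ⟨0, by simp [hdet]⟩
    · push Not at hsum
      obtain ⟨j, hj⟩ := hsum
      obtain ⟨i, -, hi⟩ := Finset.exists_ne_zero_of_sum_ne_zero hj
      have hzero : ∀ i', i' ≠ i → B i' j = 0 := by
        intro i' hne
        by_contra hi'
        refine hj ?_
        rw [Fintype.sum_eq_add i i' hne.symm, hcancel j i i' hne.symm hi hi']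
        rintro l ⟨hli, hli'⟩
        by_contra hl
        have h₁ := hcancel j i i' hne.symm hi hi'
        have h₂ := hcancel j l i hli hl hi
        have h₃ := hcancel j l i' hli' hl hi'
        omega
      rw [det_succ_column B j, Finset.sum_eq_single i (fun i' _ hne => by simp [hzero i' hne])
        (by simp)]
      obtain ⟨s, hs⟩ := hB i j
      obtain ⟨t, ht⟩ := ih (B.submatrix i.succAbove j.succAbove) (fun _ _ => hB _ _)
        fun c r r' hne => hcancel _ _ _ (Fin.succAbove_right_injective.ne hne)
      exact ⟨(-1) ^ (i + j : ℕ) * s * t, by simp [← hs, ← ht]⟩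

open Matrix in
/-- A matrix with entries in `{-1, 0, 1}` in which any two nonzero entries of a column cancel
is totally unimodular. -/
lemma isTotallyUnimodular_of_column_cancel {m n : Type*} (M : Matrix m n ℤ)
    (hM : ∀ i j, M i j ∈ Set.range SignType.cast)
    (hcancel : ∀ j i i', i ≠ i' → M i j ≠ 0 → M i' j ≠ 0 → M i j + M i' j = 0) :
    M.IsTotallyUnimodular := fun _ _ _ hf _ =>
  det_mem_range_signType_of_column_cancel _ (fun _ _ => hM _ _)
    fun _ _ _ hne => hcancel _ _ _ (hf.ne hne)

open Matrix in
/-- Multiplying rows by signs preserves total unimodularity. -/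
lemma Matrix.IsTotallyUnimodular.sign_mul_rows {m n : Type*} {M : Matrix m n ℤ}
    (hM : M.IsTotallyUnimodular) (ε : m → SignType) :
    (Matrix.of fun i j => (ε i : ℤ) * M i j).IsTotallyUnimodular := by
  intro k f g hf hg
  obtain ⟨s, hs⟩ := hM k f g hf hg
  refine ⟨(∏ i, ε (f i)) * s, ?_⟩
  have h := det_mul_column (fun i => (ε (f i) : ℤ)) (M.submatrix f g)
  rw [SignType.coe_mul, hs, ← SignType.castHom_apply, map_prod]
  exact h.symm

open Matrix in
/-- If scaling the rows of `A` by the nonzero integers `q` gives the same matrix as scaling the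
columns of a totally unimodular matrix by divisors `p` of `Δ`, then `A` is
`Δ`-regular. -/
lemma isDeltaRegular_of_scaled_isTotallyUnimodular {m n : Type*} {A : Matrix m n ℚ}
    {N : Matrix m n ℤ} (hN : N.IsTotallyUnimodular) {Δ : ℕ} (q : m → ℕ) (p : n → ℕ)
    (hq : ∀ i, q i ≠ 0) (hpΔ : ∀ j, p j ∣ Δ)
    (hA : ∀ i j, (q i : ℚ) * A i j = N i j * p j) : IsDeltaRegular A Δ := by
  intro w r c hr hc hdet i j
  set R := A.submatrix r c
  set B := N.submatrix r c with hBdef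
  have hQR : diagonal (fun i => (q (r i) : ℚ)) * R =
      B.map (Int.castRingHom ℚ) * diagonal (fun j => (p (c j) : ℚ)) := by
    ext i j
    simpa [R, B, diagonal_mul, mul_diagonal] using hA (r i) (c j)
  have hB0 : B.det ≠ 0 := by
    intro h0
    have h := congrArg det hQR
    have hmap : (B.map (Int.castRingHom ℚ)).det = 0 := by
      rw [← RingHom.mapMatrix_apply, ← RingHom.map_det, h0, map_zero]
    rw [det_mul, det_mul, hmap, zero_mul, det_diagonal] at h
    refine mul_ne_zero (Finset.prod_ne_zero_iff.mpr fun i _ => ?_) hdet h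
    exact Nat.cast_ne_zero.mpr (hq _)
  have hBunit : IsUnit B.det := by
    obtain ⟨s, hs⟩ := hN w r c hr hc
    rw [← hBdef] at hs
    rw [← hs] at hB0 ⊢
    cases s with
    | zero => exact absurd rfl hB0
    | neg => exact isUnit_one.neg
    | pos => exact isUnit_one
  have hinv : (B⁻¹).map (Int.castRingHom ℚ) * B.map (Int.castRingHom ℚ) = 1 := by
    rw [← Matrix.map_mul, nonsing_inv_mul B hBunit]
    simp
  have hR : R * R⁻¹ = 1 := mul_nonsing_inv R (isUnit_iff_ne_zero.mpr hdet)
  have hkey : diagonal (fun j => (p (c j) : ℚ)) * R⁻¹ =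
      (B⁻¹).map (Int.castRingHom ℚ) * diagonal (fun i => (q (r i) : ℚ)) := by
    calc _ = (B⁻¹).map (Int.castRingHom ℚ) * (B.map (Int.castRingHom ℚ) *
            diagonal (fun j => (p (c j) : ℚ))) * R⁻¹ := by
          rw [← Matrix.mul_assoc _ (B.map _), hinv, Matrix.one_mul]
      _ = _ := by rw [← hQR, Matrix.mul_assoc, Matrix.mul_assoc, hR, Matrix.mul_one]
  have hij := congrFun (congrFun hkey i) j
  simp only [diagonal_mul, mul_diagonal, map_apply, eq_intCast] at hij
  obtain ⟨d, hd⟩ := hpΔ (c i)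
  refine ⟨d * (B⁻¹ i j * q (r j)), ?_⟩
  push_cast
  rw [← hij, hd]
  push_cast
  ring

/-- The network matrix underlying `MISLmat`: flow conservation rows and unweighted resource
rows. -/
def lotSizingNetwork (μ η : ℕ) :
    Matrix ((Fin μ × Fin η) ⊕ Fin η) ((Fin μ × Fin (η + 1)) ⊕ (Fin μ × Fin η)) ℤ :=
  fun row col =>
    match row, col with
    | Sum.inl (i, t), Sum.inl (i', j) =>
        if i' = i then (if j = t.castSucc then 1 else if j = t.succ then -1 else 0) else 0
    | Sum.inl (i, t), Sum.inr (i', t') => if i' = i ∧ t' = t then 1 else 0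
    | Sum.inr _, Sum.inl _ => 0
    | Sum.inr t, Sum.inr (_, t') => if t' = t then -1 else 0

lemma lotSizingNetwork_isTotallyUnimodular (μ η : ℕ) :
    (lotSizingNetwork μ η).IsTotallyUnimodular := by
  apply isTotallyUnimodular_of_column_cancel
  · rintro (⟨i, t⟩ | t) (⟨i', j⟩ | ⟨i', t'⟩) <;> simp only [lotSizingNetwork] <;>
      (try split_ifs) <;>
      first
      | exact ⟨0, rfl⟩
      | exact ⟨1, rfl⟩
      | exact ⟨-1, rfl⟩
  · rintro (⟨i', j⟩ | ⟨i', t'⟩) (⟨i₁, t₁⟩ | t₁) (⟨i₂, t₂⟩ | t₂) <;>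
      simp only [lotSizingNetwork, Fin.ext_iff, Fin.val_castSucc, Fin.val_succ, ne_eq,
        Sum.inl.injEq, Sum.inr.injEq, Prod.mk.injEq] <;>
      grind

/-- The constraint matrix belonging to the continuous variables of the multi-item
single-level lot-sizing problem with joint resource constraints is `Δ`-regular with
`Δ = lcm(a¹, …, a^μ)`. -/
theorem mislmat_deltaRegular (μ η : ℕ) (hμ : 0 < μ) (hη : 0 < η)
    (a : Fin μ → ℕ) (ha : ∀ i, 0 < a i) :
    IsDeltaRegular (MISLmat μ η a) (Finset.univ.lcm a) := by
  have hTU := (((Matrix.fromRows_one_isTotallyUnimodular_iff _).mpr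
    (lotSizingNetwork_isTotallyUnimodular μ η)).submatrix
      (Sum.elim (Sum.elim (Sum.inl ∘ Sum.inl) (Sum.inl ∘ Sum.inl))
        (Sum.elim (Sum.inr ∘ Sum.inr) (Sum.inl ∘ Sum.inr))) id).sign_mul_rows
      (Sum.elim (Sum.elim (fun _ => 1) (fun _ => -1)) (Sum.elim (fun _ => -1) (fun _ => 1)))
  refine isDeltaRegular_of_scaled_isTotallyUnimodular hTU
    (Sum.elim (Sum.elim (fun x => a x.1) (fun x => a x.1)) (Sum.elim (fun x => a x.1) 1))
    (Sum.elim (fun x => a x.1) (fun x => a x.1)) ?_ ?_ ?_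
  · rintro ((x | x) | (x | x)) <;> simp [(ha _).ne']
  · rintro (x | x) <;> exact Finset.dvd_lcm (Finset.mem_univ _)
  · rintro ((⟨i, t⟩ | ⟨i, t⟩) | (⟨i, t⟩ | t)) (⟨i', j⟩ | ⟨i', t'⟩) <;>
      simp [MISLmat, lotSizingNetwork, Matrix.one_apply] <;> grind
end

section
/- Let μ, η be positive integers and a¹, …, a^μ be positive integers. Consider the (2μ+η)×(μη) integer matrix A whose columns are indexed by pairs (i,j) with i ∈ [μ] and j ∈ [η], and whose rows consist of: (1) for each i ∈ [μ], the row with entry 1 in every column (i,j), j ∈ [η], and zeros elsewhere; (2) the negations of all rows in (1); and (3) for each j ∈ [η], the row with entry −a^i in column (i,j) for each i ∈ [μ], and zeros elsewhere. Then A is Δ-regular with Δ = lcm(a¹, …, a^μ). (This is the constraint matrix belonging to the continuous transport-fraction variables of the capacitated facility location problem.) -/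
/-- The `(2μ+η) × (μη)` constraint matrix of the capacitated facility location
problem belonging to the continuous transport-fraction variables, with columns
indexed by pairs `(i, j)`, `i ∈ [μ]`, `j ∈ [η]`.  Its rows are: for each client `i`
the demand row with `1` in every column `(i, j)`; the negations of these rows;
and for each facility `j` the capacity row with `-aⁱ` in column `(i, j)`. -/
def CFLmat (μ η : ℕ) (a : Fin μ → ℕ) :
    Matrix (Fin μ ⊕ (Fin μ ⊕ Fin η)) (Fin μ × Fin η) ℚ :=
  fun row col =>
    match row with
    | Sum.inl i => if col.1 = i then 1 else 0
    | Sum.inr (Sum.inl i) => if col.1 = i then -1 else 0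
    | Sum.inr (Sum.inr j) => if col.2 = j then -(a col.1 : ℚ) else 0

/-- The vertex-edge incidence matrix of a directed graph, given by the source and the target of
each edge, is totally unimodular. -/
theorem Matrix.isTotallyUnimodular_sourceTarget {V E : Type*} [DecidableEq V] (s t : E → V) :
    (Matrix.of fun v e => (if v = s e then 1 else 0) - (if v = t e then 1 else 0) :
      Matrix V E ℤ).IsTotallyUnimodular := by
  intro k
  induction k with
  | zero => intro f g _ _; exact ⟨1, by simp⟩
  | succ k ih =>
    intro f g hf hg
    set N : Matrix V E ℤ :=
      Matrix.of fun v e => (if v = s e then 1 else 0) - (if v = t e then 1 else 0) with hN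
    by_cases hcol : ∃ j i₀, ∀ i, i ≠ i₀ → N (f i) (g j) = 0
    · obtain ⟨j, i₀, h⟩ := hcol
      rw [Matrix.det_succ_column _ j, Finset.sum_eq_single i₀ (by
        intro i _ hi; simp [h i hi]) (by simp), Matrix.submatrix_submatrix]
      obtain ⟨d, hd⟩ := ih (f ∘ i₀.succAbove) (g ∘ j.succAbove)
        (hf.comp Fin.succAbove_right_injective) (hg.comp Fin.succAbove_right_injective)
      have hentry : N (f i₀) (g j) ∈ Set.range SignType.cast := by
        simp only [hN, Matrix.of_apply]
        split_ifs
        exacts [⟨0, by simp⟩, ⟨1, by simp⟩, ⟨-1, by simp⟩, ⟨0, by simp⟩]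
      obtain ⟨e, he⟩ := hentry
      refine ⟨(-1) ^ (i₀ + j : ℕ) * e * d, ?_⟩
      rw [← hd, Matrix.submatrix_apply, ← he]
      simp
    · push Not at hcol
      refine ⟨0, ?_⟩
      rw [SignType.coe_zero, eq_comm]
      refine Matrix.exists_vecMul_eq_zero_iff.mp ⟨1, one_ne_zero, ?_⟩
      ext j
      have hs : ∃ i, f i = s (g j) := by
        by_contra! hs
        by_cases ht : ∃ i, f i = t (g j)
        · obtain ⟨i, hi⟩ := ht
          obtain ⟨i', hne, h⟩ := hcol j i
          have : f i' ≠ t (g j) := fun h' => hne (hf (h'.trans hi.symm))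
          simp [hN, hs, this] at h
        · push Not at ht
          obtain ⟨i', -, h⟩ := hcol j 0
          simp [hN, hs, ht] at h
      obtain ⟨p, hp⟩ := hs
      obtain ⟨q, hqp, hq⟩ := hcol j p
      have hqs : f q ≠ s (g j) := fun h' => hqp (hf (h'.trans hp.symm))
      have hqt : f q = t (g j) := by
        by_contra h'
        simp [hN, hqs, h'] at hq
      simp [Matrix.vecMul, dotProduct, hN, ← hp, ← hqt, hf.eq_iff, Finset.sum_sub_distrib]

/-- The constraint matrix belonging to the continuous transport-fraction variables
of the capacitated facility location problem is `Δ`-regular with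
`Δ = lcm(a¹, …, a^μ)`. -/
theorem cflmat_deltaRegular (μ η : ℕ) (hμ : 0 < μ) (hη : 0 < η)
    (a : Fin μ → ℕ) (ha : ∀ i, 0 < a i) :
    IsDeltaRegular (CFLmat μ η a) (Finset.univ.lcm a) := by
  intro w r c _ _ hdet i j
  let N : Matrix (Fin μ ⊕ Fin η) (Fin μ × Fin η) ℤ := Matrix.of fun v e =>
    (if v = Sum.inl e.1 then 1 else 0) - (if v = Sum.inr e.2 then 1 else 0)
  have hN : N.IsTotallyUnimodular := Matrix.isTotallyUnimodular_sourceTarget _ _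
  let v : Fin μ ⊕ (Fin μ ⊕ Fin η) → Fin μ ⊕ Fin η := Sum.elim Sum.inl id
  let ρ : Fin μ ⊕ (Fin μ ⊕ Fin η) → ℤ :=
    Sum.elim (fun i => a i) (Sum.elim (fun i => -a i) (fun _ => 1))
  have ha' : ∀ i, (a i : ℚ) ≠ 0 := fun i => by exact_mod_cast (ha i).ne'
  have hρ : ∀ x, (ρ x : ℚ) ≠ 0 := by
    rintro (x | x | x) <;> simp [ρ, ha']
  have hA : ∀ x e, CFLmat μ η a x e = (ρ x : ℚ)⁻¹ * N (v x) e * a e.1 := by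
    rintro (x | x | x) ⟨e₁, e₂⟩
    · rcases eq_or_ne e₁ x with rfl | h
      · simp [CFLmat, ρ, N, v, ha']
      · simp [CFLmat, ρ, N, v, h, h.symm]
    · rcases eq_or_ne e₁ x with rfl | h
      · simp [CFLmat, ρ, N, v, ha']
      · simp [CFLmat, ρ, N, v, h, h.symm]
    · rcases eq_or_ne e₂ x with rfl | h
      · simp [CFLmat, ρ, N, v]
      · simp [CFLmat, ρ, N, v, h, h.symm]
  set M : Matrix (Fin w) (Fin w) ℤ := N.submatrix (v ∘ r) c with hM
  have hR : (CFLmat μ η a).submatrix r c = Matrix.diagonal (fun x => (ρ (r x) : ℚ)⁻¹) *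
      M.map (Int.castRingHom ℚ) * Matrix.diagonal (fun y => (a (c y).1 : ℚ)) := by
    ext x y
    simp [Matrix.mul_diagonal, Matrix.diagonal_mul, hA, hM]
  have hMdet : IsUnit M.det := by
    obtain ⟨d, hd⟩ := (Matrix.isTotallyUnimodular_iff N).mp hN w (v ∘ r) c
    have h0 : M.det ≠ 0 := by
      intro h0
      apply hdet
      rw [hR, Matrix.det_mul, Matrix.det_mul, ← RingHom.mapMatrix_apply, ← RingHom.map_det, h0]
      simp
    rw [← hM] at hd
    rw [← hd] at h0 ⊢
    cases d <;> simp at h0 ⊢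
  have hinv : ((CFLmat μ η a).submatrix r c)⁻¹ = Matrix.diagonal (fun y => (a (c y).1 : ℚ)⁻¹) *
      M⁻¹.map (Int.castRingHom ℚ) * Matrix.diagonal (fun x => (ρ (r x) : ℚ)) := by
    apply Matrix.inv_eq_left_inv
    have h₁ : Matrix.diagonal (fun x => (ρ (r x) : ℚ)) *
        Matrix.diagonal (fun x => (ρ (r x) : ℚ)⁻¹) = 1 := by
      simp [Matrix.diagonal_mul_diagonal, hρ]
    have h₂ : Matrix.diagonal (fun y => (a (c y).1 : ℚ)⁻¹) *
        Matrix.diagonal (fun y => (a (c y).1 : ℚ)) = 1 := by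
      simp [Matrix.diagonal_mul_diagonal, ha']
    have h₃ : M⁻¹.map (Int.castRingHom ℚ) * M.map (Int.castRingHom ℚ) = 1 := by
      rw [← Matrix.map_mul, Matrix.nonsing_inv_mul _ hMdet]
      simp
    rw [hR]
    simp only [Matrix.mul_assoc]
    rw [← Matrix.mul_assoc (Matrix.diagonal fun x => (ρ (r x) : ℚ)), h₁, Matrix.one_mul,
      ← Matrix.mul_assoc (M⁻¹.map _), h₃, Matrix.one_mul, h₂]
  obtain ⟨k, hk⟩ := Finset.dvd_lcm (f := a) (Finset.mem_univ (c i).1)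
  refine ⟨k * M⁻¹ i j * ρ (r j), ?_⟩
  rw [hinv, hk, Matrix.mul_diagonal, Matrix.diagonal_mul]
  have := ha' (c i).1
  simp only [Matrix.map_apply, eq_intCast]
  push_cast
  field_simp
end

section
/- Let μ, η be positive integers and a¹, …, a^μ be positive integers, and let A be the constraint matrix of the multi-item single-level lot-sizing problem with joint resource constraints: columns grouped as (s¹, …, s^μ, x¹, …, x^μ) with s^i ∈ ℚ^{η+1}, x^i ∈ ℚ^{η}; rows consisting of, for each i ∈ [μ], the rows (H on the s^i-columns, I_η on the x^i-columns) with H the η×(η+1) matrix with H_{t,t}=1, H_{t,t+1}=−1; the negations of these rows; the rows (−I_η on the x^i-columns) for each i; and the η rows with entries −a^i·I_η on the x^i-columns. Then A is minimal Δ-regular with Δ = lcm(a¹, …, a^μ), i.e., A is lcm(a¹,…,a^μ)-regular and A is not s-regular for any positive integer s < lcm(a¹,…,a^μ). -/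
/-- If every column of an integer matrix with entries in `{-1, 0, 1}` contains at most one `1` and at
most one `-1` (as in the incidence matrix of a directed graph), then the matrix is totally
unimodular. -/
theorem isTotallyUnimodular_of_column_injective {m n : Type*} {A : Matrix m n ℤ}
    (hA : ∀ i k, A i k = 0 ∨ A i k = 1 ∨ A i k = -1)
    (hinj : ∀ i j k, A i k ≠ 0 → A i k = A j k → i = j) :
    A.IsTotallyUnimodular := by
  intro w
  induction w with
  | zero => intro f g _ _; exact ⟨1, by simp⟩
  | succ w ih =>
    intro f g hf hg
    by_cases h : ∃ k i, ∀ j, j ≠ i → A (f j) (g k) = 0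
    · obtain ⟨k, i, hk⟩ := h
      rw [Matrix.det_succ_column _ k, Finset.sum_eq_single i
        (fun j _ hj => by simp [hk j hj]) (by simp)]
      have h₁ := ih (f ∘ i.succAbove) (g ∘ k.succAbove)
        (hf.comp Fin.succAbove_right_injective) (hg.comp Fin.succAbove_right_injective)
      rw [Matrix.submatrix_submatrix]
      simp only [SignType.range_eq, Set.mem_insert_iff, Set.mem_singleton_iff] at h₁ ⊢
      rw [Matrix.submatrix_apply]
      rcases neg_one_pow_eq_or ℤ ((i : ℕ) + k) with h₂ | h₂ <;>
      rcases hA (f i) (g k) with h₃ | h₃ | h₃ <;>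
      rcases h₁ with h₁ | h₁ | h₁ <;> simp [h₁, h₂, h₃]
    · push Not at h
      refine ⟨0, ?_⟩
      rw [SignType.coe_zero, eq_comm, ← Matrix.exists_vecMul_eq_zero_iff]
      refine ⟨fun _ => 1, fun h0 => by simpa using congrFun h0 0, ?_⟩
      ext k
      obtain ⟨i, -, hi⟩ := h k 0
      obtain ⟨j, hji, hj⟩ := h k i
      have hne : A (f i) (g k) ≠ A (f j) (g k) :=
        fun he => hji (hf (hinj _ _ _ hi he)).symm
      have hz : ∀ l, l ≠ i ∧ l ≠ j → A (f l) (g k) = 0 := by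
        rintro l ⟨hli, hlj⟩
        by_contra hl
        have h₁ : A (f l) (g k) ≠ A (f i) (g k) := fun he => hli (hf (hinj _ _ _ hl he))
        have h₂ : A (f l) (g k) ≠ A (f j) (g k) := fun he => hlj (hf (hinj _ _ _ hl he))
        have := hA (f l) (g k)
        have := hA (f i) (g k)
        have := hA (f j) (g k)
        omega
      simp only [Matrix.vecMul, dotProduct, one_mul, Matrix.submatrix_apply, Pi.zero_apply]
      rw [Fintype.sum_eq_add i j hji.symm hz]
      have := hA (f i) (g k)
      have := hA (f j) (g k)
      omega

/-- A matrix obtained from a totally unimodular matrix by scaling the rows by `p` and the columns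
by `q` is `Δ`-regular as soon as all the numbers `Δ / (p r * q c)` are integers. -/
theorem isDeltaRegular_of_scaled_isTotallyUnimodular_s14 {m n : Type*} {A : Matrix m n ℚ}
    {B : Matrix m n ℤ} (hB : B.IsTotallyUnimodular) {p : m → ℚ} {q : n → ℚ}
    (hp : ∀ r, p r ≠ 0) (hq : ∀ c, q c ≠ 0) (hA : ∀ r c, A r c = p r * B r c * q c) {Δ : ℕ}
    (hΔ : ∀ r c, ∃ z : ℤ, (Δ : ℚ) * (q c)⁻¹ * (p r)⁻¹ = z) :
    IsDeltaRegular A Δ := by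
  intro w r c hr hc hdet i j
  set M := B.submatrix r c with hM
  have hR : A.submatrix r c =
      Matrix.diagonal (p ∘ r) * M.map (Int.castRingHom ℚ) * Matrix.diagonal (q ∘ c) := by
    ext k l
    simp [Matrix.mul_diagonal, Matrix.diagonal_mul, hA, hM]
  have hMdet : IsUnit M.det := by
    have h := hB w r c hr hc
    have h0 : M.det ≠ 0 := by
      intro h0
      apply hdet
      rw [hR, Matrix.det_mul, Matrix.det_mul, ← RingHom.mapMatrix_apply, ← RingHom.map_det, h0]
      simp
    simp only [SignType.range_eq, Set.mem_insert_iff, Set.mem_singleton_iff, ← hM] at h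
    rw [Int.isUnit_iff]
    tauto
  have hMinv : (M.map (Int.castRingHom ℚ))⁻¹ = M⁻¹.map (Int.castRingHom ℚ) := by
    apply Matrix.inv_eq_right_inv
    rw [← Matrix.map_mul, Matrix.mul_nonsing_inv _ hMdet]
    simp
  have hdiag : ∀ v : Fin w → ℚ, (∀ k, v k ≠ 0) →
      (Matrix.diagonal v)⁻¹ = Matrix.diagonal fun k => (v k)⁻¹ := by
    intro v hv
    apply Matrix.inv_eq_right_inv
    simp [Matrix.diagonal_mul_diagonal, hv]
  obtain ⟨z, hz⟩ := hΔ (r j) (c i)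
  refine ⟨z * M⁻¹ i j, ?_⟩
  rw [hR, Matrix.mul_inv_rev, Matrix.mul_inv_rev, hdiag (p ∘ r) fun k => hp (r k),
    hdiag (q ∘ c) fun k => hq (c k), hMinv, Matrix.diagonal_mul, Matrix.mul_diagonal]
  push_cast
  rw [← hz]
  simp only [Function.comp_apply, Matrix.map_apply, eq_intCast]
  ring

/-- The incidence matrix of the directed graph underlying the multi-item lot-sizing problem: the
flow conservation rows together with the resource rows for unit resource consumption. -/
def lotSizingIncidence (μ η : ℕ) :
    Matrix ((Fin μ × Fin η) ⊕ Fin η) ((Fin μ × Fin (η + 1)) ⊕ (Fin μ × Fin η)) ℤ :=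
  fun row col =>
    match row, col with
    | Sum.inl (i, t), Sum.inl (i', j) =>
        if i' = i then (if j = t.castSucc then 1 else if j = t.succ then -1 else 0)
        else 0
    | Sum.inl (i, t), Sum.inr (i', t') => if i' = i ∧ t' = t then 1 else 0
    | Sum.inr _, Sum.inl _ => 0
    | Sum.inr t, Sum.inr (_, t') => if t' = t then -1 else 0

theorem lotSizingIncidence_isTotallyUnimodular (μ η : ℕ) :
    (lotSizingIncidence μ η).IsTotallyUnimodular := by
  apply isTotallyUnimodular_of_column_injective
  · rintro (⟨i, t⟩ | t) (⟨i', j⟩ | ⟨i', t'⟩) <;> simp only [lotSizingIncidence] <;>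
      (try split_ifs) <;> simp
  · rintro (⟨i₁, t₁⟩ | t₁) (⟨i₂, t₂⟩ | t₂) (⟨i', j⟩ | ⟨i', t'⟩) <;>
      simp only [lotSizingIncidence, Fin.ext_iff, Fin.val_castSucc, Fin.val_succ,
        Sum.inl.injEq, Sum.inr.injEq, Prod.mk.injEq, reduceCtorEq] <;>
      (try split_ifs) <;> simp <;> omega

/-- The row of `Matrix.fromRows (lotSizingIncidence μ η) 1` of which the given row of
`MISLmat μ η a` is a rescaling. -/
def lotSizingRow (μ η : ℕ) :
    ((Fin μ × Fin η) ⊕ (Fin μ × Fin η)) ⊕ ((Fin μ × Fin η) ⊕ Fin η) →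
      ((Fin μ × Fin η) ⊕ Fin η) ⊕ ((Fin μ × Fin (η + 1)) ⊕ (Fin μ × Fin η))
  | Sum.inl (Sum.inl x) => Sum.inl (Sum.inl x)
  | Sum.inl (Sum.inr x) => Sum.inl (Sum.inl x)
  | Sum.inr (Sum.inl x) => Sum.inr (Sum.inr x)
  | Sum.inr (Sum.inr t) => Sum.inl (Sum.inr t)

/-- The row scaling factors of `MISLmat`. -/
def lotSizingRowScale (μ η : ℕ) (a : Fin μ → ℕ) :
    ((Fin μ × Fin η) ⊕ (Fin μ × Fin η)) ⊕ ((Fin μ × Fin η) ⊕ Fin η) → ℚ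
  | Sum.inl (Sum.inl (i, _)) => (a i : ℚ)⁻¹
  | Sum.inl (Sum.inr (i, _)) => -(a i : ℚ)⁻¹
  | Sum.inr (Sum.inl (i, _)) => -(a i : ℚ)⁻¹
  | Sum.inr (Sum.inr _) => 1

/-- The column scaling factors of `MISLmat`. -/
def lotSizingColScale (μ η : ℕ) (a : Fin μ → ℕ) :
    (Fin μ × Fin (η + 1)) ⊕ (Fin μ × Fin η) → ℚ
  | Sum.inl (i, _) => a i
  | Sum.inr (i, _) => a i

theorem MISLmat_eq_scaled (μ η : ℕ) (a : Fin μ → ℕ) (ha : ∀ i, 0 < a i) (r c) :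
    MISLmat μ η a r c = lotSizingRowScale μ η a r *
      ((Matrix.fromRows (lotSizingIncidence μ η) 1).submatrix (lotSizingRow μ η) id r c : ℤ) *
      lotSizingColScale μ η a c := by
  have ha' : ∀ i, (a i : ℚ) ≠ 0 := fun i => by exact_mod_cast (ha i).ne'
  rcases r with ((⟨i, t⟩ | ⟨i, t⟩) | (⟨i, t⟩ | t)) <;> rcases c with (⟨i', j⟩ | ⟨i', j⟩) <;>
    simp only [MISLmat, lotSizingRowScale, lotSizingColScale, lotSizingRow, lotSizingIncidence,
      Matrix.submatrix_apply, Matrix.fromRows_apply_inl, Matrix.fromRows_apply_inr,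
      Matrix.one_apply, id, Sum.inr.injEq, Prod.mk.injEq, reduceCtorEq] <;>
    (try split_ifs) <;> simp_all

theorem MISLmat_isDeltaRegular_lcm (μ η : ℕ) (a : Fin μ → ℕ) (ha : ∀ i, 0 < a i) :
    IsDeltaRegular (MISLmat μ η a) (Finset.univ.lcm a) := by
  have ha' : ∀ i, (a i : ℚ) ≠ 0 := fun i => by exact_mod_cast (ha i).ne'
  refine isDeltaRegular_of_scaled_isTotallyUnimodular_s14
    ((lotSizingIncidence_isTotallyUnimodular μ η).fromRows_one.submatrix (lotSizingRow μ η) id)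
    (p := lotSizingRowScale μ η a) (q := lotSizingColScale μ η a) ?_ ?_
    (MISLmat_eq_scaled μ η a ha) ?_
  · rintro ((⟨i, t⟩ | ⟨i, t⟩) | (⟨i, t⟩ | t)) <;> simp [lotSizingRowScale, ha']
  · rintro (⟨i, t⟩ | ⟨i, t⟩) <;> simp [lotSizingColScale, ha']
  · intro r c
    have hq : ∃ z : ℤ, ((Finset.univ.lcm a : ℕ) : ℚ) * (lotSizingColScale μ η a c)⁻¹ = z := by
      obtain ⟨i, hi⟩ : ∃ i, lotSizingColScale μ η a c = a i := by
        rcases c with (⟨i, t⟩ | ⟨i, t⟩) <;> exact ⟨i, rfl⟩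
      obtain ⟨z, hz⟩ := Finset.dvd_lcm (f := a) (Finset.mem_univ i)
      refine ⟨z, ?_⟩
      rw [hi, hz]
      have := ha' i
      push_cast
      field_simp
    have hp : ∃ z : ℤ, (lotSizingRowScale μ η a r)⁻¹ = z := by
      rcases r with ((⟨i, t⟩ | ⟨i, t⟩) | (⟨i, t⟩ | t))
      · exact ⟨a i, by simp [lotSizingRowScale]⟩
      · exact ⟨-a i, by simp [lotSizingRowScale, inv_neg]⟩
      · exact ⟨-a i, by simp [lotSizingRowScale, inv_neg]⟩
      · exact ⟨1, by simp [lotSizingRowScale]⟩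
    obtain ⟨y, hy⟩ := hq
    obtain ⟨z, hz⟩ := hp
    exact ⟨y * z, by rw [hy, hz]; push_cast; rfl⟩

/-- The `1 × 1` submatrices of an `s`-regular matrix: negative integer entries divide `s`. -/
theorem IsDeltaRegular.dvd_of_apply_eq_neg {m n : Type*} {A : Matrix m n ℚ} {s : ℕ}
    (hA : IsDeltaRegular A s) {r : m} {c : n} {b : ℕ} (hb : 0 < b) (hrc : A r c = -(b : ℚ)) :
    b ∣ s := by
  have hb' : (b : ℚ) ≠ 0 := by exact_mod_cast hb.ne'
  have hdet : (A.submatrix (fun _ : Fin 1 => r) (fun _ : Fin 1 => c)).det ≠ 0 := by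
    simp [hrc, hb']
  obtain ⟨z, hz⟩ := hA 1 (fun _ => r) (fun _ => c) (Function.injective_of_subsingleton _)
    (Function.injective_of_subsingleton _) hdet 0 0
  have h := congrFun (congrFun
    (Matrix.mul_nonsing_inv _ (isUnit_iff_ne_zero.mpr hdet)) 0) 0
  simp only [Matrix.mul_apply, Fin.sum_univ_one, Matrix.submatrix_apply, hrc,
    Matrix.one_apply_eq] at h
  have hs : (s : ℚ) = ((b * -z : ℤ) : ℚ) := by
    push_cast
    rw [← hz]
    linear_combination (-(s : ℚ)) * h
  exact Int.natCast_dvd_natCast.mp ⟨-z, by exact_mod_cast hs⟩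

/-- The constraint matrix belonging to the continuous variables of the multi-item
single-level lot-sizing problem with joint resource constraints is minimal
`Δ`-regular with `Δ = lcm(a¹, …, a^μ)`: it is `lcm(a¹,…,a^μ)`-regular and it is not
`s`-regular for any positive integer `s < lcm(a¹,…,a^μ)`. -/
theorem mislmat_minimal_deltaRegular (μ η : ℕ) (hμ : 0 < μ) (hη : 0 < η)
    (a : Fin μ → ℕ) (ha : ∀ i, 0 < a i) :
    IsDeltaRegular (MISLmat μ η a) (Finset.univ.lcm a) ∧
      ∀ s : ℕ, 0 < s → s < Finset.univ.lcm a →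
        ¬ IsDeltaRegular (MISLmat μ η a) s := by
  refine ⟨MISLmat_isDeltaRegular_lcm μ η a ha, fun s hs hlt hreg => ?_⟩
  refine hlt.not_ge (Nat.le_of_dvd hs (Finset.lcm_dvd fun i _ => ?_))
  exact hreg.dvd_of_apply_eq_neg (r := Sum.inr (Sum.inr ⟨0, hη⟩)) (c := Sum.inr (i, ⟨0, hη⟩))
    (ha i) (by simp [MISLmat])
end

section
/- Let μ, η be positive integers and a¹, …, a^μ be positive integers, and let A be the constraint matrix of the capacitated facility location problem: columns indexed by pairs (i,j), i ∈ [μ], j ∈ [η]; rows consisting of, for each i ∈ [μ], the row with entry 1 in every column (i,j); the negations of these rows; and for each j ∈ [η], the row with entry −a^i in column (i,j) for each i ∈ [μ]. Then A is minimal Δ-regular with Δ = lcm(a¹, …, a^μ), i.e., A is lcm(a¹,…,a^μ)-regular and A is not s-regular for any positive integer s < lcm(a¹,…,a^μ). -/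
/-- The vertex-arc incidence matrix of the complete bipartite graph on `α ⊕ β`, with every edge
oriented from `β` to `α`. -/
def bipartiteIncidence (α β : Type*) [DecidableEq α] [DecidableEq β] :
    Matrix (α ⊕ β) (α × β) ℤ :=
  fun v e => Sum.elim (fun i => if e.1 = i then 1 else 0) (fun j => if e.2 = j then -1 else 0) v

lemma bipartiteIncidence_det_submatrix {α β : Type*} [DecidableEq α] [DecidableEq β] {w : ℕ}
    (r : Fin w → α ⊕ β) (c : Fin w → α × β) :
    ((bipartiteIncidence α β).submatrix r c).det ∈ Set.range SignType.cast := by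
  induction w with
  | zero => exact ⟨1, by simp⟩
  | succ w ih =>
    set T := (bipartiteIncidence α β).submatrix r c with hT
    by_cases hr : Function.Injective r
    swap
    · obtain ⟨x, y, hxy, hne⟩ : ∃ x y, r x = r y ∧ x ≠ y := by
        simpa [Function.Injective] using hr
      exact ⟨0, by simp [Matrix.det_zero_of_row_eq hne (M := T) (by ext k; simp [hT, hxy])]⟩
    by_cases hk : ∃ k p, ∀ q, q ≠ p → T q k = 0
    · obtain ⟨k, p, hp⟩ := hk
      rw [Matrix.det_succ_column T k, Finset.sum_eq_single p
        (fun q _ hq => by rw [hp q hq]; ring) (by simp)]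
      obtain ⟨s, hs⟩ := ih (r ∘ p.succAbove) (c ∘ k.succAbove)
      have hentry : T p k ∈ Set.range (SignType.cast : SignType → ℤ) := by
        simp only [hT, Matrix.submatrix_apply, bipartiteIncidence]
        rcases r p with i | j <;> simp only [Sum.elim_inl, Sum.elim_inr] <;> split_ifs
        exacts [⟨1, rfl⟩, ⟨0, rfl⟩, ⟨-1, rfl⟩, ⟨0, rfl⟩]
      obtain ⟨t, ht⟩ := hentry
      refine ⟨(-1) ^ (p + k : ℕ) * t * s, ?_⟩
      rw [hT, Matrix.submatrix_submatrix, ← hs, ← hT, ← ht]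
      simp
    · push Not at hk
      have hsum : ∀ k, ∑ q, T q k = 0 := by
        intro k
        have hval : ∀ q, T q k =
            (if r q = Sum.inl (c k).1 then 1 else 0) + (if r q = Sum.inr (c k).2 then -1 else 0) := by
          intro q
          simp only [hT, Matrix.submatrix_apply, bipartiteIncidence]
          rcases r q with i | j <;> simp [eq_comm]
        have hl : ∃ p, r p = Sum.inl (c k).1 := by
          by_contra! h
          obtain ⟨q, -, hq⟩ := hk k 0
          have hq' : r q = Sum.inr (c k).2 := by
            by_contra h'
            exact hq (by rw [hval, if_neg (h q), if_neg h', add_zero])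
          obtain ⟨q', hne, hq''⟩ := hk k q
          exact hq'' (by
            rw [hval, if_neg (h q'), if_neg (fun h' => hne (hr (h'.trans hq'.symm))), add_zero])
        have hr' : ∃ p, r p = Sum.inr (c k).2 := by
          by_contra! h
          obtain ⟨p, hp⟩ := hl
          obtain ⟨q, hne, hq⟩ := hk k p
          exact hq (by
            rw [hval, if_neg (h q), if_neg (fun h' => hne (hr (h'.trans hp.symm))), add_zero])
        obtain ⟨p, hp⟩ := hl
        obtain ⟨q, hq⟩ := hr'
        simp_rw [hval, Finset.sum_add_distrib, ← hp, ← hq, hr.eq_iff]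
        simp
      refine ⟨0, ?_⟩
      rw [SignType.coe_zero, eq_comm]
      exact Matrix.exists_vecMul_eq_zero_iff.mp
        ⟨fun _ => 1, fun h => one_ne_zero (congrFun h 0), by
          ext k; simpa [Matrix.vecMul, dotProduct] using hsum k⟩

/-- If `R` arises from an integer matrix of determinant `±1` by scaling rows and columns, then its
inverse arises from an integer matrix by the inverse scalings. -/
lemma exists_inv_eq_of_row_col_scaling {w : ℕ} (R : Matrix (Fin w) (Fin w) ℚ)
    (M : Matrix (Fin w) (Fin w) ℤ) (hM : IsUnit M.det) (e d : Fin w → ℚ)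
    (he : ∀ x, e x ≠ 0) (hd : ∀ y, d y ≠ 0) (hR : ∀ x y, R x y = e x * M x y * d y) :
    ∃ N : Matrix (Fin w) (Fin w) ℤ, ∀ y x, R⁻¹ y x = (d y)⁻¹ * N y x * (e x)⁻¹ := by
  refine ⟨M⁻¹, fun y x => ?_⟩
  have hinv : R⁻¹ = Matrix.of fun y x => (d y)⁻¹ * (M⁻¹ y x : ℚ) * (e x)⁻¹ := by
    apply Matrix.inv_eq_right_inv
    ext x z
    have h1 : ∑ y, M x y * M⁻¹ y z = (1 : Matrix (Fin w) (Fin w) ℤ) x z := by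
      rw [← Matrix.mul_nonsing_inv M hM, Matrix.mul_apply]
    have h2 : ∑ y, (M x y : ℚ) * (M⁻¹ y z : ℚ) = if x = z then 1 else 0 := by
      rw [Matrix.one_apply] at h1
      exact_mod_cast h1
    calc (R * Matrix.of fun y x => (d y)⁻¹ * (M⁻¹ y x : ℚ) * (e x)⁻¹) x z
        = ∑ y, e x * (M x y * M⁻¹ y z) * (e z)⁻¹ := by
          rw [Matrix.mul_apply]
          refine Finset.sum_congr rfl fun y _ => ?_
          have := hd y
          rw [hR, Matrix.of_apply]
          field_simp
      _ = e x * (if x = z then 1 else 0) * (e z)⁻¹ := by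
          rw [← Finset.sum_mul, ← Finset.mul_sum, h2]
      _ = (1 : Matrix (Fin w) (Fin w) ℚ) x z := by
          rw [Matrix.one_apply]
          split_ifs with h
          · subst h; simp [he x]
          · simp
  rw [hinv, Matrix.of_apply]

/-- The vertex of the bipartite client-facility graph to which a row of `CFLmat` belongs. -/
def CFLmat.rowVertex {μ η : ℕ} : Fin μ ⊕ (Fin μ ⊕ Fin η) → Fin μ ⊕ Fin η :=
  Sum.elim Sum.inl id

/-- The integer whose inverse scales a row of the incidence matrix to a row of `CFLmat`. -/
def CFLmat.rowScale {μ η : ℕ} (a : Fin μ → ℕ) : Fin μ ⊕ (Fin μ ⊕ Fin η) → ℤ :=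
  Sum.elim (fun i => a i) (Sum.elim (fun i => -a i) fun _ => 1)

lemma CFLmat.rowScale_ne_zero {μ η : ℕ} {a : Fin μ → ℕ} (ha : ∀ i, 0 < a i)
    (x : Fin μ ⊕ (Fin μ ⊕ Fin η)) : CFLmat.rowScale a x ≠ 0 := by
  rcases x with i | i | j
  · simpa [rowScale] using (ha i).ne'
  · simpa [rowScale] using (ha i).ne'
  · simp [rowScale]

lemma CFLmat_eq_scaled_incidence {μ η : ℕ} {a : Fin μ → ℕ} (ha : ∀ i, 0 < a i)
    (x : Fin μ ⊕ (Fin μ ⊕ Fin η)) (y : Fin μ × Fin η) :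
    CFLmat μ η a x y = (CFLmat.rowScale a x : ℚ)⁻¹ *
      (bipartiteIncidence (Fin μ) (Fin η) (CFLmat.rowVertex x) y : ℚ) * (a y.1 : ℚ) := by
  have h : (a y.1 : ℚ) ≠ 0 := by exact_mod_cast (ha y.1).ne'
  rcases x with i | i | j <;>
    simp only [CFLmat, CFLmat.rowScale, CFLmat.rowVertex, bipartiteIncidence, Sum.elim_inl,
      Sum.elim_inr, id_eq] <;> split_ifs with hi <;> try subst hi
  all_goals simp [h, neg_inv.symm]

lemma CFLmat_isDeltaRegular_lcm {μ η : ℕ} {a : Fin μ → ℕ} (ha : ∀ i, 0 < a i) :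
    IsDeltaRegular (CFLmat μ η a) (Finset.univ.lcm a) := by
  intro w r c _ _ hdet y x
  set M := (bipartiteIncidence (Fin μ) (Fin η)).submatrix (CFLmat.rowVertex ∘ r) c with hM
  have hscale : ∀ x y, (CFLmat μ η a).submatrix r c x y =
      (CFLmat.rowScale a (r x) : ℚ)⁻¹ * (M x y : ℚ) * (a (c y).1 : ℚ) :=
    fun x y => CFLmat_eq_scaled_incidence ha (r x) (c y)
  have hM0 : M.det ≠ 0 := by
    intro h0
    apply hdet
    have hfac : (CFLmat μ η a).submatrix r c =
        Matrix.diagonal (fun x => (CFLmat.rowScale a (r x) : ℚ)⁻¹) * M.map (Int.cast : ℤ → ℚ) *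
          Matrix.diagonal (fun y => (a (c y).1 : ℚ)) := by
      ext x y
      rw [hscale, Matrix.mul_diagonal, Matrix.diagonal_mul, Matrix.map_apply]
    have hmap : (M.map (Int.cast : ℤ → ℚ)).det = 0 := by
      rw [← Int.cast_det, h0, Int.cast_zero]
    rw [hfac, Matrix.det_mul, Matrix.det_mul, hmap, mul_zero, zero_mul]
  have hunit : IsUnit M.det := by
    obtain ⟨s, hs⟩ := bipartiteIncidence_det_submatrix (CFLmat.rowVertex ∘ r) c
    rw [← hM] at hs
    cases s
    · exact absurd hs.symm hM0
    · exact Int.isUnit_iff.mpr (Or.inr hs.symm)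
    · exact Int.isUnit_iff.mpr (Or.inl hs.symm)
  have hne : ∀ y, (a (c y).1 : ℚ) ≠ 0 := fun y => by exact_mod_cast (ha _).ne'
  obtain ⟨N, hN⟩ := exists_inv_eq_of_row_col_scaling _ M hunit _ _
    (fun x => inv_ne_zero (Int.cast_ne_zero.mpr (CFLmat.rowScale_ne_zero ha (r x)))) hne hscale
  obtain ⟨k, hk⟩ := Finset.dvd_lcm (f := a) (Finset.mem_univ (c y).1)
  refine ⟨k * N y x * CFLmat.rowScale a (r x), ?_⟩
  have := hne y
  rw [hN, hk, inv_inv]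
  push_cast
  field_simp

lemma lcm_dvd_of_CFLmat_isDeltaRegular {μ η : ℕ} (hη : 0 < η) {a : Fin μ → ℕ}
    (ha : ∀ i, 0 < a i) {s : ℕ} (hs : IsDeltaRegular (CFLmat μ η a) s) :
    Finset.univ.lcm a ∣ s := by
  refine Finset.lcm_dvd fun i _ => ?_
  have hne : (a i : ℚ) ≠ 0 := by exact_mod_cast (ha i).ne'
  set R := (CFLmat μ η a).submatrix (fun _ : Fin 1 => Sum.inr (Sum.inr ⟨0, hη⟩))
    (fun _ => (i, ⟨0, hη⟩)) with hR
  have hdet : R.det = -(a i : ℚ) := by simp [hR, CFLmat]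
  obtain ⟨z, hz⟩ := hs 1 _ _ (Function.injective_of_subsingleton _)
    (Function.injective_of_subsingleton _) (hdet.trans_ne (neg_ne_zero.mpr hne)) 0 0
  have hinv : R⁻¹ 0 0 = (-(a i : ℚ))⁻¹ := by
    rw [Matrix.inv_def, hdet]
    simp
  rw [← hR, hinv] at hz
  have h : (s : ℚ) = a i * (-z : ℤ) := by
    push_cast
    rw [← hz]
    field_simp
  exact Int.natCast_dvd_natCast.mp ⟨-z, by exact_mod_cast h⟩

/-- The constraint matrix belonging to the continuous transport-fraction variables
of the capacitated facility location problem is minimal `Δ`-regular with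
`Δ = lcm(a¹, …, a^μ)`: it is `lcm(a¹,…,a^μ)`-regular and it is not `s`-regular for
any positive integer `s < lcm(a¹,…,a^μ)`. -/
theorem cflmat_minimal_deltaRegular (μ η : ℕ) (hμ : 0 < μ) (hη : 0 < η)
    (a : Fin μ → ℕ) (ha : ∀ i, 0 < a i) :
    IsDeltaRegular (CFLmat μ η a) (Finset.univ.lcm a) ∧
      ∀ s : ℕ, 0 < s → s < Finset.univ.lcm a →
        ¬ IsDeltaRegular (CFLmat μ η a) s := by
  exact ⟨CFLmat_isDeltaRegular_lcm ha, fun s hs hlt h =>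
    hlt.not_ge (Nat.le_of_dvd hs (lcm_dvd_of_CFLmat_isDeltaRegular hη ha h))⟩
end

section
/- Let A ∈ ℤ^{m×n} be Δ-regular for a positive integer Δ, and let b ∈ ℤ^m. Then every extreme point of the polyhedron P(A,b) = {x ∈ ℝⁿ : Ax ≥ b, x ≥ 0} lies in the lattice (1/Δ)ℤⁿ, i.e., Δ·x̄ ∈ ℤⁿ for every extreme point x̄ of P(A,b). -/
/-- A matrix over a field with linearly independent columns has a nonsingular square submatrix
using all of its columns. -/
theorem Matrix.exists_submatrix_det_ne_zero {K m : Type*} [Field K] [Finite m] {w : ℕ}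
    (B : Matrix m (Fin w) K) (hB : ∀ v, B.mulVec v = 0 → v = 0) :
    ∃ r : Fin w → m, Function.Injective r ∧ (B.submatrix r id).det ≠ 0 := by
  have := Fintype.ofFinite m
  have hrank : B.rank = w := by
    have hinj : Function.Injective B.mulVecLin :=
      (injective_iff_map_eq_zero _).2 fun v hv => hB v (by simpa using hv)
    rw [Matrix.rank, LinearMap.finrank_range_of_inj hinj, Module.finrank_fin_fun]
  obtain ⟨κ, a, ha, hspan, hli⟩ := exists_linearIndependent' K B.row
  have := Finite.of_injective a ha
  have := Fintype.ofFinite κ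
  have hcard : Fintype.card κ = w := by
    rw [← finrank_span_eq_card hli, hspan, ← Matrix.rank_eq_finrank_span_row, hrank]
  let e : Fin w ≃ κ := (Fintype.equivFinOfCardEq hcard).symm
  refine ⟨a ∘ e, ha.comp e.injective, ?_⟩
  rw [← isUnit_iff_ne_zero, ← Matrix.isUnit_iff_isUnit_det,
    ← Matrix.linearIndependent_rows_iff_isUnit]
  exact hli.comp e e.injective

/-- At an extreme point `x` of `{x | A x ≥ b, x ≥ 0}`, a direction that vanishes on the zero
coordinates of `x` and is orthogonal to all tight rows is zero. -/
theorem eq_zero_of_mem_extremePoints {m n : Type*} [Finite m] [Fintype n] (A : Matrix m n ℝ)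
    (b : m → ℝ) {x : n → ℝ}
    (hx : x ∈ Set.extremePoints ℝ {x : n → ℝ | (∀ i, b i ≤ ∑ j, A i j * x j) ∧ ∀ j, 0 ≤ x j})
    {d : n → ℝ} (hd : ∀ j, x j = 0 → d j = 0)
    (hA : ∀ i, ∑ j, A i j * x j = b i → ∑ j, A i j * d j = 0) : d = 0 := by
  obtain ⟨⟨hxb, hx0⟩, hext⟩ := mem_extremePoints.1 hx
  have hev : ∀ᶠ t : ℝ in nhds 0,
      (∀ i, b i ≤ ∑ j, A i j * (x + t • d) j) ∧ ∀ j, 0 ≤ (x + t • d) j := by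
    refine (Filter.eventually_all.2 fun i => ?_).and (Filter.eventually_all.2 fun j => ?_)
    · have hsum (t : ℝ) : ∑ j, A i j * (x + t • d) j =
          ∑ j, A i j * x j + t * ∑ j, A i j * d j := by
        rw [Finset.mul_sum, ← Finset.sum_add_distrib]
        exact Finset.sum_congr rfl fun j _ => by simp; ring
      simp only [hsum]
      rcases (hxb i).eq_or_lt with h | h
      · simp [hA i h.symm, hxb i]
      · have hc : Continuous fun t : ℝ => ∑ j, A i j * x j + t * ∑ j, A i j * d j := by fun_prop
        exact ((hc.tendsto 0).eventually_const_lt (by simpa using h)).mono fun t ht => ht.le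
    · rcases (hx0 j).eq_or_lt with h | h
      · simp [← h, hd j h.symm]
      · have hc : Continuous fun t : ℝ => (x + t • d) j := by simp; fun_prop
        exact ((hc.tendsto 0).eventually_const_lt (by simpa using h)).mono fun t ht => ht.le
  have hneg := (continuous_neg.tendsto' (0 : ℝ) 0 neg_zero).eventually hev
  obtain ⟨t, ⟨h₁, h₂⟩, ht⟩ := (((hev.and hneg).filter_mono nhdsWithin_le_nhds).and
    (self_mem_nhdsWithin (a := (0 : ℝ)) (s := Set.Ioi 0))).exists
  have hseg : x ∈ openSegment ℝ (x + t • d) (x + (-t) • d) :=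
    ⟨1 / 2, 1 / 2, by norm_num, by norm_num, by norm_num, by module⟩
  have h := (hext _ h₁ _ h₂ hseg).1
  exact (smul_eq_zero.1 (add_eq_left.1 h)).resolve_left ht.ne'

/-- If `A` is an integral `Δ`-regular matrix, a real solution of a nonsingular square subsystem
of `A` with integral right-hand side becomes integral when multiplied by `Δ`. -/
theorem IsDeltaRegular.exists_int_mul_eq {m n : Type*} {A : Matrix m n ℤ} {Δ : ℕ}
    (hreg : IsDeltaRegular (A.map (fun z => (z : ℚ))) Δ) {w : ℕ} {r : Fin w → m} {c : Fin w → n}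
    (hr : Function.Injective r) (hc : Function.Injective c) (hdet : (A.submatrix r c).det ≠ 0)
    {b : Fin w → ℤ} {y : Fin w → ℝ}
    (hy : ∀ k, ∑ l, (A (r k) (c l) : ℝ) * y l = b k) (l : Fin w) :
    ∃ z : ℤ, (Δ : ℝ) * y l = z := by
  set R := (A.map (fun z => (z : ℚ))).submatrix r c
  have hRdet : R.det ≠ 0 := by
    have : R.det = ((A.submatrix r c).det : ℚ) := by
      rw [Int.cast_det]
      rfl
    rw [this]
    exact_mod_cast hdet
  choose Z hZ using hreg w r c hr hc hRdet
  have hZR (k : Fin w) : ∑ i, Z l i * A (r i) (c k) = if l = k then (Δ : ℤ) else 0 := by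
    have h := congrFun (congrFun (Matrix.nonsing_inv_mul R hRdet.isUnit) l) k
    rw [Matrix.mul_apply, Matrix.one_apply] at h
    have h' : ∑ i, (Z l i : ℚ) * (A (r i) (c k) : ℚ) = if l = k then (Δ : ℚ) else 0 := by
      simp_rw [← hZ, mul_assoc]
      rw [← Finset.mul_sum]
      simpa [R] using congrArg ((Δ : ℚ) * ·) h
    exact_mod_cast h'
  refine ⟨∑ i, Z l i * b i, ?_⟩
  have hZR' (k : Fin w) :
      ∑ i, (Z l i : ℝ) * (A (r i) (c k) : ℝ) = if l = k then (Δ : ℝ) else 0 := by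
    exact_mod_cast congrArg (Int.cast : ℤ → ℝ) (hZR k)
  calc (Δ : ℝ) * y l
      = ∑ k, (∑ i, (Z l i : ℝ) * (A (r i) (c k) : ℝ)) * y k := by simp [hZR']
    _ = ∑ i, (Z l i : ℝ) * ∑ k, (A (r i) (c k) : ℝ) * y k := by
      simp_rw [Finset.sum_mul, Finset.mul_sum, mul_assoc]
      exact Finset.sum_comm
    _ = _ := by simp [hy]

/-- If `A ∈ ℤ^{m×n}` is `Δ`-regular and `b ∈ ℤ^m`, then every extreme point of the
polyhedron `P(A,b) = {x ∈ ℝⁿ : Ax ≥ b, x ≥ 0}` lies in the lattice `(1/Δ)ℤⁿ`. -/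
theorem extremePoint_mem_lattice {m n : ℕ} (A : Matrix (Fin m) (Fin n) ℤ)
    (Δ : ℕ) (hΔ : 0 < Δ) (hreg : IsDeltaRegular (A.map (fun z => (z : ℚ))) Δ)
    (b : Fin m → ℤ) :
    ∀ x ∈ Set.extremePoints ℝ
        {x : Fin n → ℝ | (∀ i, (b i : ℝ) ≤ ∑ j, (A i j : ℝ) * x j) ∧ ∀ j, 0 ≤ x j},
      ∀ j, ∃ z : ℤ, (Δ : ℝ) * x j = (z : ℝ) := by
  intro x hx j
  by_cases hj : x j = 0
  · exact ⟨0, by simp [hj]⟩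
  let e : Fin (Fintype.card {j // x j ≠ 0}) ≃ {j // x j ≠ 0} := (Fintype.equivFin _).symm
  let T := {i // ∑ j, (A i j : ℝ) * x j = b i}
  have hsupp (i : Fin m) (v : Fin n → ℝ) (hv : ∀ j, x j = 0 → v j = 0) :
      ∑ l, (A i (e l) : ℝ) * v (e l) = ∑ j, (A i j : ℝ) * v j := by
    rw [e.sum_comp fun j => (A i j : ℝ) * v j, ← Fintype.sum_subtype_add_sum_subtype (x · ≠ 0),
      left_eq_add]
    exact Finset.sum_eq_zero fun j _ => by rw [hv j (not_not.1 j.2), mul_zero]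
  let B : Matrix T (Fin (Fintype.card {j // x j ≠ 0})) ℝ := Matrix.of fun i l => (A i (e l) : ℝ)
  obtain ⟨r, hr, hdet⟩ := B.exists_submatrix_det_ne_zero fun v hv => by
    let d : Fin n → ℝ := fun j => if h : x j ≠ 0 then v (e.symm ⟨j, h⟩) else 0
    have hde (l) : d (e l) = v l := by simp [d, (e l).2]
    have hd (j) (h : x j = 0) : d j = 0 := by simp [d, h]
    have hd0 : d = 0 := eq_zero_of_mem_extremePoints (A.map (fun z => (z : ℝ)))
      (fun i => (b i : ℝ)) hx hd fun i hi => by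
        have := congrFun hv ⟨i, hi⟩
        simpa [B, Matrix.mulVec, dotProduct, ← hde, hsupp i d hd] using this
    ext l
    rw [← hde, hd0]
    rfl
  have hdet' : (A.submatrix (fun k => (r k : Fin m)) (fun l => (e l : Fin n))).det ≠ 0 := by
    intro h
    apply hdet
    have := congrArg (Int.cast : ℤ → ℝ) h
    rw [Int.cast_det, Int.cast_zero] at this
    exact this
  obtain ⟨z, hz⟩ := hreg.exists_int_mul_eq (Subtype.val_injective.comp hr)
    (Subtype.val_injective.comp e.injective) hdet' (b := fun k => b (r k))
    (y := fun l => x (e l)) (fun k => (hsupp _ x fun _ h => h).trans (r k).2) (e.symm ⟨j, hj⟩)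
  exact ⟨z, by simpa using hz⟩
end

section
/- Consider the mixed-integer linear problem min{cᵀx + dᵀy : Ax + By ≥ g, x ≥ 0, y ≥ 0, y ∈ ℤ^ℓ} with c ∈ ℤⁿ, d ∈ ℤ^ℓ, A ∈ ℤ^{m×n}, B ∈ ℤ^{m×ℓ}, g ∈ ℤ^m, variables (x,y) ∈ ℝⁿ×ℝ^ℓ, and feasible set X. Suppose A is Δ-regular for a positive integer Δ, suppose (x*, y*) ∈ X is an optimal solution (it minimizes cᵀx + dᵀy over X), and suppose the polyhedron {x ∈ ℝⁿ : Ax ≥ g − By*, x ≥ 0} is bounded. Then there exists an optimal solution (x^{Δ*}, y^{Δ*}) ∈ X with Δ·x^{Δ*} ∈ ℤⁿ and y^{Δ*} ∈ ℤ^ℓ, i.e., an optimal solution lying in X ∩ (1/Δ)ℤ^{n+ℓ}. -/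
open Filter Topology in
/-- A direction that vanishes on all tight constraints can be followed for a positive time. -/
theorem exists_pos_feasible_step {ι V : Type*} [Finite ι] [AddCommGroup V] [Module ℝ V]
    (f : ι → V →ₗ[ℝ] ℝ) (β : ι → ℝ) {x v : V} (hx : ∀ i, β i ≤ f i x)
    (hv : ∀ i, f i x = β i → f i v = 0) :
    ∃ ε : ℝ, 0 < ε ∧ ∀ i, β i ≤ f i (x + ε • v) := by
  have key : ∀ᶠ ε in 𝓝[>] (0 : ℝ), ∀ i, β i ≤ f i (x + ε • v) := by
    rw [eventually_all]
    intro i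
    rcases (hx i).eq_or_lt with h | h
    · refine Eventually.of_forall fun ε => ?_
      simp [hv i h.symm, h]
    · have hc : ContinuousAt (fun ε : ℝ => f i x + ε * f i v) 0 := by fun_prop
      have := hc.eventually_const_lt (u := β i) (by simpa using h)
      filter_upwards [this.filter_mono nhdsWithin_le_nhds] with ε hε
      simpa using hε.le
  obtain ⟨ε, h1, h2⟩ := (key.and self_mem_nhdsWithin).exists
  exact ⟨ε, h2, h1⟩

/-- If the constraint functionals separate points, a linear program with an optimal solution
has an optimal solution at which the tight constraints separate points. -/
theorem exists_optimal_vertex {ι V : Type*} [Fintype ι] [AddCommGroup V] [Module ℝ V]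
    (f : ι → V →ₗ[ℝ] ℝ) (β : ι → ℝ) (φ : V →ₗ[ℝ] ℝ)
    (hf : ∀ v, (∀ i, f i v = 0) → v = 0) {x₀ : V} (hx₀ : ∀ i, β i ≤ f i x₀)
    (hopt : ∀ y, (∀ i, β i ≤ f i y) → φ x₀ ≤ φ y) :
    ∃ x, (∀ i, β i ≤ f i x) ∧ φ x = φ x₀ ∧
      ∀ v, (∀ i, f i x = β i → f i v = 0) → v = 0 := by
  classical
  let T : V → Finset ι := fun x => Finset.univ.filter fun i => f i x = β i
  let S : Set V := {x | (∀ i, β i ≤ f i x) ∧ φ x = φ x₀}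
  have hbd : BddAbove ((fun x => (T x).card) '' S) := by
    refine ⟨Fintype.card ι, ?_⟩
    rintro _ ⟨x, -, rfl⟩
    exact Finset.card_le_univ _
  obtain ⟨x, ⟨hx, hφ⟩, hmax⟩ := Nat.sSup_mem (s := (fun x => (T x).card) '' S)
    ⟨_, x₀, ⟨hx₀, rfl⟩, rfl⟩ hbd
  have hmax' : ∀ y ∈ S, (T y).card ≤ (T x).card := fun y hy =>
    (le_csSup hbd ⟨y, hy, rfl⟩).trans hmax.ge
  refine ⟨x, hx, hφ, ?_⟩
  by_contra! hcon
  obtain ⟨v, hv, hv0⟩ := hcon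
  obtain ⟨w, hw, i₀, hi₀⟩ : ∃ w, (∀ i, f i x = β i → f i w = 0) ∧ ∃ i, f i w < 0 := by
    have : ∃ i, f i v ≠ 0 := by
      by_contra! h
      exact hv0 (hf v h)
    obtain ⟨i, hi⟩ := this
    rcases hi.lt_or_gt with h | h
    · exact ⟨v, hv, i, h⟩
    · exact ⟨-v, fun i h => by simp [hv i h], i, by simpa using h⟩
  have hφw : φ w = 0 := by
    have nonneg : ∀ u, (∀ i, f i x = β i → f i u = 0) → 0 ≤ φ u := by
      intro u hu
      obtain ⟨ε, hε, h⟩ := exists_pos_feasible_step f β hx hu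
      have := hopt _ h
      rw [map_add, map_smul, hφ, smul_eq_mul] at this
      exact nonneg_of_mul_nonneg_right (by linarith : 0 ≤ ε * φ u) hε
    have h1 := nonneg w hw
    have h2 := nonneg (-w) fun i h => by simp [hw i h]
    rw [map_neg] at h2
    linarith
  obtain ⟨k, hk, hmin⟩ := Finset.exists_min_image (Finset.univ.filter fun i => f i w < 0)
    (fun i => (f i x - β i) / (-f i w)) ⟨i₀, by simpa using hi₀⟩
  simp only [Finset.mem_filter, Finset.mem_univ, true_and] at hk hmin
  set t := (f k x - β k) / (-f k w) with ht
  have ht0 : 0 ≤ t := div_nonneg (by linarith [hx k]) (by linarith)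
  have hfeas : ∀ i, β i ≤ f i (x + t • w) := by
    intro i
    rw [map_add, map_smul, smul_eq_mul]
    rcases lt_or_ge (f i w) 0 with h | h
    · have := hmin i h
      rw [le_div_iff₀ (by linarith)] at this
      linarith
    · have := mul_nonneg ht0 h
      linarith [hx i]
  have hlt : T x ⊂ T (x + t • w) := by
    rw [Finset.ssubset_iff_of_subset]
    · refine ⟨k, ?_, ?_⟩
      · have : f k w ≠ 0 := hk.ne
        simp only [T, Finset.mem_filter, Finset.mem_univ, true_and, map_add, map_smul,
          smul_eq_mul, ht]
        field_simp
        ring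
      · simp only [T, Finset.mem_filter, Finset.mem_univ, true_and]
        exact fun h => hk.ne (hw k h)
    · intro i hi
      simp only [T, Finset.mem_filter, Finset.mem_univ, true_and] at hi ⊢
      simp [hi, hw i hi]
  exact (Finset.card_lt_card hlt).not_ge (hmax' _ ⟨hfeas, by simp [hφw, hφ]⟩)

/-- A matrix over a field with trivial kernel has a nonsingular square submatrix using all
columns. -/
theorem Matrix.exists_injective_isUnit_submatrix {K m : Type*} [Field K] [Finite m] {w : ℕ}
    (M : Matrix m (Fin w) K) (hM : Function.Injective M.mulVec) :
    ∃ r : Fin w → m, Function.Injective r ∧ IsUnit (M.submatrix r id) := by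
  have hrank : Module.finrank K (Submodule.span K (Set.range M.row)) = w := by
    rw [← M.rank_eq_finrank_span_row, Matrix.rank,
      LinearMap.finrank_range_of_inj (f := M.mulVecLin) hM, Module.finrank_fin_fun]
  obtain ⟨f, hf, hli⟩ : ∃ f : Fin w → Fin w → K, (∀ i, f i ∈ Set.range M.row) ∧
      LinearIndependent K f := by
    obtain ⟨f, hf, -, hli⟩ := Submodule.exists_fun_fin_finrank_span_eq K (Set.range M.row)
    exact ⟨f ∘ finCongr hrank.symm, fun i => hf _, hli.comp _ (finCongr hrank.symm).injective⟩
  choose r hr using hf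
  have hrow : (M.submatrix r id).row = f := funext hr
  refine ⟨r, fun i j hij => hli.injective ?_, ?_⟩
  · rw [← hr, ← hr, hij]
  · rw [← Matrix.linearIndependent_rows_iff_isUnit, hrow]
    exact hli

/-- The coordinates of a vertex of `{x | A x ≥ b, x ≥ 0}` with integral data and `Δ`-regular `A`
are integral multiples of `1 / Δ`. -/
theorem IsDeltaRegular.exists_int_mul_vertex {m n : Type*} [Finite m] [Fintype n]
    {A : Matrix m n ℤ} {Δ : ℕ} (hreg : IsDeltaRegular (A.map (fun z => (z : ℚ))) Δ)
    (b : m → ℤ) (x : n → ℝ)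
    (hx : ∀ v : n → ℝ, (∀ i, ∑ j, (A i j : ℝ) * x j = b i → ∑ j, (A i j : ℝ) * v j = 0) →
      (∀ j, x j = 0 → v j = 0) → v = 0) (j : n) :
    ∃ z : ℤ, (Δ : ℝ) * x j = z := by
  classical
  rcases eq_or_ne (x j) 0 with hj | hj
  · exact ⟨0, by simp [hj]⟩
  let e := (Fintype.equivFin {j // x j ≠ 0}).symm
  have hsum : ∀ (i : m) (v : n → ℝ), (∀ j, x j = 0 → v j = 0) →
      ∑ k, (A i (e k) : ℝ) * v (e k) = ∑ j, (A i j : ℝ) * v j := by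
    intro i v hv
    rw [e.sum_comp (fun j : {j // x j ≠ 0} => (A i j : ℝ) * v j),
      ← Finset.sum_subtype (Finset.univ.filter (x · ≠ 0)) (by simp)
        (fun j => (A i j : ℝ) * v j)]
    refine Finset.sum_subset (Finset.subset_univ _) fun j _ hj => ?_
    rw [hv j (by simpa using hj), mul_zero]
  let M : Matrix {i // ∑ j, (A i j : ℝ) * x j = b i} (Fin (Fintype.card {j // x j ≠ 0})) ℝ :=
    fun i k => A i (e k)
  have hM : Function.Injective M.mulVec := by
    refine (injective_iff_map_eq_zero M.mulVecLin).2 fun u hu => ?_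
    let v : n → ℝ := fun j => if h : x j ≠ 0 then u (e.symm ⟨j, h⟩) else 0
    have hv : ∀ j, x j = 0 → v j = 0 := fun j h => by simp [v, h]
    have hvu : ∀ k, v (e k) = u k := fun k => by simp [v, (e k).2]
    have hv0 : v = 0 := by
      refine hx v (fun i hi => ?_) hv
      rw [← hsum i v hv]
      simp_rw [hvu]
      exact congrFun hu ⟨i, hi⟩
    ext k
    simp [← hvu, hv0]
  obtain ⟨r, hr, hunit⟩ := M.exists_injective_isUnit_submatrix hM
  let R : Matrix _ _ ℤ := A.submatrix (fun k => (r k : m)) (fun k => (e k : n))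
  have hdet : R.det ≠ 0 := by
    intro h
    have h1 : M.submatrix r id = R.map (Int.castRingHom ℝ) := rfl
    rw [Matrix.isUnit_iff_isUnit_det, h1, ← RingHom.mapMatrix_apply, ← RingHom.map_det, h] at hunit
    simp at hunit
  have hRQ : (A.map (fun z => (z : ℚ))).submatrix (fun k => (r k : m)) (fun k => (e k : n)) =
      R.map (Int.castRingHom ℚ) := rfl
  have hdetQ : (R.map (Int.castRingHom ℚ)).det ≠ 0 := by
    rw [← RingHom.mapMatrix_apply, ← RingHom.map_det]
    simpa using hdet
  have hZ := hreg _ (fun k => (r k : m)) (fun k => (e k : n))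
    (Subtype.val_injective.comp hr) (Subtype.val_injective.comp e.injective)
  rw [hRQ] at hZ
  choose Z hZ using hZ hdetQ
  have hZR : Matrix.of Z * R = (Δ : ℤ) • (1 : Matrix _ _ ℤ) := by
    have h2 : (Matrix.of Z).map (Int.castRingHom ℚ) =
        (Δ : ℚ) • (R.map (Int.castRingHom ℚ))⁻¹ := by
      ext i k
      exact (hZ i k).symm
    apply Matrix.map_injective (Int.castRingHom ℚ).injective_int
    beta_reduce
    rw [Matrix.map_mul, h2, Matrix.smul_mul, Matrix.nonsing_inv_mul _ hdetQ.isUnit]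
    ext i k
    simp only [Matrix.smul_apply, Matrix.map_apply, Matrix.one_apply]
    split_ifs <;> simp
  let k := e.symm ⟨j, hj⟩
  refine ⟨∑ i, Z k i * b (r i), ?_⟩
  have hb : ∀ i, (b (r i) : ℝ) = ∑ l, (R i l : ℝ) * x (e l) := fun i => by
    rw [← (r i).2, ← hsum _ x fun _ h => h]
    rfl
  have hrow : ∀ l, ∑ i, (Z k i : ℝ) * R i l = if k = l then (Δ : ℝ) else 0 := fun l => by
    have := congrFun (congrFun hZR k) l
    simp only [Matrix.mul_apply, Matrix.of_apply, Matrix.smul_apply, Matrix.one_apply] at this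
    have := congrArg (Int.cast : ℤ → ℝ) this
    simpa using this
  push_cast
  simp_rw [hb, Finset.mul_sum]
  rw [Finset.sum_comm]
  simp_rw [← mul_assoc, ← Finset.sum_mul, hrow]
  simp [k]

/-- For the mixed-integer linear problem
`min{cᵀx + dᵀy : Ax + By ≥ g, x ≥ 0, y ≥ 0, y ∈ ℤ^ℓ}` with integer data, if the matrix
`A` belonging to the continuous variables is `Δ`-regular, `(x*, y*)` is an optimal
solution, and the polyhedron `{x : Ax ≥ g - By*, x ≥ 0}` is bounded, then there
exists an optimal solution lying in `X ∩ (1/Δ)ℤ^{n+ℓ}`, i.e. an optimal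
`(x^{Δ*}, y^{Δ*}) ∈ X` with `Δ·x^{Δ*} ∈ ℤⁿ` and `y^{Δ*} ∈ ℤ^ℓ`. -/
theorem exists_optimal_in_lattice {m n ℓ : ℕ}
    (c : Fin n → ℤ) (d : Fin ℓ → ℤ)
    (A : Matrix (Fin m) (Fin n) ℤ) (B : Matrix (Fin m) (Fin ℓ) ℤ) (g : Fin m → ℤ)
    (Δ : ℕ) (hΔ : 0 < Δ) (hreg : IsDeltaRegular (A.map (fun z => (z : ℚ))) Δ)
    (X : Set ((Fin n → ℝ) × (Fin ℓ → ℝ)))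
    (hX : X = {p | (∀ i, (g i : ℝ) ≤
          ∑ j, (A i j : ℝ) * p.1 j + ∑ j, (B i j : ℝ) * p.2 j) ∧
        (∀ j, 0 ≤ p.1 j) ∧ (∀ j, 0 ≤ p.2 j) ∧ (∀ j, ∃ z : ℤ, p.2 j = (z : ℝ))})
    (xstar : Fin n → ℝ) (ystar : Fin ℓ → ℝ)
    (hfeas : (xstar, ystar) ∈ X)
    (hopt : ∀ p ∈ X, ∑ j, (c j : ℝ) * xstar j + ∑ j, (d j : ℝ) * ystar j ≤
        ∑ j, (c j : ℝ) * p.1 j + ∑ j, (d j : ℝ) * p.2 j)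
    (hbdd : Bornology.IsBounded {x : Fin n → ℝ |
        (∀ i, (g i : ℝ) - ∑ j, (B i j : ℝ) * ystar j ≤ ∑ j, (A i j : ℝ) * x j) ∧
        ∀ j, 0 ≤ x j}) :
    ∃ p ∈ X, (∀ j, ∃ z : ℤ, (Δ : ℝ) * p.1 j = (z : ℝ)) ∧
      (∀ j, ∃ z : ℤ, p.2 j = (z : ℝ)) ∧
      ∑ j, (c j : ℝ) * p.1 j + ∑ j, (d j : ℝ) * p.2 j =
        ∑ j, (c j : ℝ) * xstar j + ∑ j, (d j : ℝ) * ystar j := by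
  subst hX
  obtain ⟨hrow, hx0, hy0, hyint⟩ := hfeas
  simp only at hrow hx0 hy0 hyint
  choose y hy using hyint
  obtain rfl : ystar = fun j => (y j : ℝ) := funext hy
  let b : Fin m → ℤ := fun i => g i - ∑ j, B i j * y j
  have hb : ∀ i, (b i : ℝ) = g i - ∑ j, (B i j : ℝ) * y j := fun i => by simp [b]
  let f : Fin m ⊕ Fin n → (Fin n → ℝ) →ₗ[ℝ] ℝ :=
    Sum.elim (fun i => ∑ j, (A i j : ℝ) • LinearMap.proj j) LinearMap.proj
  have hfl : ∀ i v, f (.inl i) v = ∑ j, (A i j : ℝ) * v j := fun i v => by simp [f]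
  have hfr : ∀ j v, f (.inr j) v = v j := fun j v => by simp [f]
  let φ : (Fin n → ℝ) →ₗ[ℝ] ℝ := ∑ j, (c j : ℝ) • LinearMap.proj j
  have hφ : ∀ v, φ v = ∑ j, (c j : ℝ) * v j := fun v => by simp [φ]
  obtain ⟨x, hx, hval, hvert⟩ := exists_optimal_vertex f (Sum.elim (fun i => (b i : ℝ)) 0) φ
    (fun v hv => funext fun j => by simpa [hfr] using hv (.inr j)) (x₀ := xstar)
    (by
      rintro (i | j)
      · simp only [Sum.elim_inl, hfl, hb]
        linarith [hrow i]
      · simpa [hfr] using hx0 j)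
    (by
      intro v hv
      have := hopt (v, fun j => (y j : ℝ)) ⟨fun i => ?_, fun j => ?_, hy0, fun j => ⟨y j, rfl⟩⟩
      · simp only at this
        rw [hφ, hφ]
        linarith
      · have := hv (.inl i)
        simp only [Sum.elim_inl, hfl, hb] at this
        simp only
        linarith
      · simpa [hfr] using hv (.inr j))
  simp only [Sum.forall, Sum.elim_inl, Sum.elim_inr, hfl, hfr, Pi.zero_apply] at hx hvert
  refine ⟨(x, fun j => (y j : ℝ)), ⟨fun i => ?_, hx.2, hy0, fun j => ⟨y j, rfl⟩⟩,
    hreg.exists_int_mul_vertex b x fun v h1 h2 => hvert v ⟨h1, h2⟩, fun j => ⟨y j, rfl⟩, ?_⟩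
  · have := hx.1 i
    rw [hb] at this
    simp only
    linarith
  · rw [hφ, hφ] at hval
    simp only [hval]
end
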